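/- Let T be the 4×4 complex matrix T = (1/√2) · [[1,0,0,1],[0,i,i,0],[0,−1,1,0],[i,0,0,−i]]. For every complex 4×4 matrix M with Mᵀ M = I₄ and det M = 1 (i.e. M ∈ SO(4,ℂ)), there exist A, B ∈ SL(2,ℂ) such that M = T (A ⊗ B) T†. In other words, the homomorphism (A,B) ↦ T(A⊗B)T† from SL(2,ℂ)×SL(2,ℂ) onto SO(4,ℂ) is surjective. -/

import Mathlib

open Matrix

noncomputable section

/-- The fixed matrix `T = (1/√2)·[[1,0,0,1],[0,i,i,0],[0,-1,1,0],[i,0,0,-i]]`. -/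
noncomputable def Tmat : Matrix (Fin 4) (Fin 4) ℂ :=
  ((1 / Real.sqrt 2 : ℝ) : ℂ) •
    !![1, 0, 0, 1;
       0, Complex.I, Complex.I, 0;
       0, -1, 1, 0;
       Complex.I, 0, 0, -Complex.I]

/-- The index identification `(i,j) ↦ 2i+j` between `Fin 2 × Fin 2` (ordered 00,01,10,11)
and `Fin 4`. -/
def qIdx : Fin 2 × Fin 2 ≃ Fin 4 where
  toFun p := ⟨2 * p.1.val + p.2.val, by have h1 := p.1.isLt; have h2 := p.2.isLt; omega⟩
  invFun k := (⟨k.val / 2, by have := k.isLt; omega⟩, ⟨k.val % 2, by have := k.isLt; omega⟩)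
  left_inv := by decide
  right_inv := by decide

/-- Kronecker product of two `2×2` matrices as a `4×4` matrix (basis ordered 00,01,10,11). -/
def kron (A B : Matrix (Fin 2) (Fin 2) ℂ) : Matrix (Fin 4) (Fin 4) ℂ :=
  fun r c => A (qIdx.symm r).1 (qIdx.symm c).1 * B (qIdx.symm r).2 (qIdx.symm c).2

/-- The Gram matrix `ε ⊗ ε` of the polarized determinant on `2×2` matrices. -/
def detForm : Matrix (Fin 4) (Fin 4) ℂ :=
  !![0, 0, 0, 1; 0, 0, -1, 0; 0, -1, 0, 0; 1, 0, 0, 0]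

lemma kron_eq (A B : Matrix (Fin 2) (Fin 2) ℂ) :
    kron A B = !![A 0 0 * B 0 0, A 0 0 * B 0 1, A 0 1 * B 0 0, A 0 1 * B 0 1;
                  A 0 0 * B 1 0, A 0 0 * B 1 1, A 0 1 * B 1 0, A 0 1 * B 1 1;
                  A 1 0 * B 0 0, A 1 0 * B 0 1, A 1 1 * B 0 0, A 1 1 * B 0 1;
                  A 1 0 * B 1 0, A 1 0 * B 1 1, A 1 1 * B 1 0, A 1 1 * B 1 1] := by
  ext i j
  fin_cases i <;> fin_cases j <;> rfl

lemma kron_eq_submatrix (A B : Matrix (Fin 2) (Fin 2) ℂ) :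
    kron A B = (kroneckerMap (· * ·) A B).submatrix qIdx.symm qIdx.symm :=
  rfl

lemma kron_mul (A B C D : Matrix (Fin 2) (Fin 2) ℂ) :
    kron A B * kron C D = kron (A * C) (B * D) := by
  rw [kron_eq_submatrix, kron_eq_submatrix, kron_eq_submatrix, submatrix_mul_equiv]
  exact congrArg (fun X => submatrix X qIdx.symm qIdx.symm) (mul_kronecker_mul A C B D).symm

lemma det_kron (A B : Matrix (Fin 2) (Fin 2) ℂ) :
    (kron A B).det = A.det ^ 2 * B.det ^ 2 := by
  rw [kron_eq_submatrix, det_submatrix_equiv_self]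
  simpa using det_kronecker A B

lemma kron_one_one : kron 1 1 = 1 := by
  simp [kron_eq_submatrix]

lemma kron_transpose_mul_detForm_mul_kron (A B : Matrix (Fin 2) (Fin 2) ℂ) :
    (kron A B)ᵀ * detForm * kron A B = (A.det * B.det) • detForm := by
  rw [kron_eq, detForm, det_fin_two, det_fin_two]
  ext i j
  fin_cases i <;> fin_cases j <;>
    simp [Matrix.mul_apply, Fin.sum_univ_four] <;> ring

lemma inv_sqrt_two_sq : ((√2 : ℝ) : ℂ)⁻¹ * ((√2 : ℝ) : ℂ)⁻¹ = 1 / 2 := by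
  rw [← mul_inv, ← Complex.ofReal_mul, Real.mul_self_sqrt (by norm_num)]
  norm_num

lemma Tmat_mul_conjTranspose : Tmat * Tmatᴴ = 1 := by
  have h := inv_sqrt_two_sq
  ext i j
  fin_cases i <;> fin_cases j <;>
    simp [Tmat, Matrix.mul_apply, Fin.sum_univ_four] <;> grind [Complex.I_mul_I]

lemma Tmat_transpose_mul : Tmatᵀ * Tmat = detForm := by
  have h := inv_sqrt_two_sq
  ext i j
  fin_cases i <;> fin_cases j <;>
    simp [Tmat, detForm, Matrix.mul_apply, Fin.sum_univ_four] <;> grind [Complex.I_mul_I]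

lemma exists_mul_eq_of_mul_eq_mul {a b c d : ℂ} (h : a * d = b * c) :
    ∃ p q r s : ℂ, a = p * r ∧ b = p * s ∧ c = q * r ∧ d = q * s := by
  by_cases ha : a = 0
  · by_cases hb : b = 0
    · exact ⟨0, 1, c, d, by simp [ha], by simp [hb], by simp, by simp⟩
    · have hc : c = 0 := by simpa [ha, hb] using h.symm
      exact ⟨b, d, 0, 1, by simp [ha], by simp, by simp [hc], by simp⟩
  · exact ⟨1, c / a, a, b, by simp, by simp, by field_simp, by field_simp; linear_combination h⟩

lemma transpose_mul_detForm_mul_apply (N : Matrix (Fin 4) (Fin 4) ℂ) (i j : Fin 4) :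
    (Nᵀ * detForm * N) i j =
      N 0 i * N 3 j - N 1 i * N 2 j - N 2 i * N 1 j + N 3 i * N 0 j := by
  simp [detForm, Matrix.mul_apply, Fin.sum_univ_four]
  ring

/-- An isometry of the determinant form takes the hyperbolic pair `E₁₁, E₂₂` to a hyperbolic pair
of rank-one matrices, which some `A ⊗ B` also attains. -/
lemma exists_kron_cols_eq {N : Matrix (Fin 4) (Fin 4) ℂ} (hN : Nᵀ * detForm * N = detForm) :
    ∃ A B : Matrix (Fin 2) (Fin 2) ℂ, A.det = 1 ∧ B.det = 1 ∧
      ∀ i, kron A B i 0 = N i 0 ∧ kron A B i 3 = N i 3 := by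
  have e (i j : Fin 4) := (transpose_mul_detForm_mul_apply N i j).symm.trans (congr_fun₂ hN i j)
  have e00 := e 0 0
  have e33 := e 3 3
  have e03 := e 0 3
  simp only [detForm, of_apply, cons_val] at e00 e33 e03
  obtain ⟨p, q, r, s, h0, h1, h2, h3⟩ :=
    exists_mul_eq_of_mul_eq_mul (a := N 0 0) (b := N 1 0) (c := N 2 0) (d := N 3 0)
      (by linear_combination e00 / 2)
  obtain ⟨p', q', r', s', h0', h1', h2', h3'⟩ :=
    exists_mul_eq_of_mul_eq_mul (a := N 0 3) (b := N 1 3) (c := N 2 3) (d := N 3 3)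
      (by linear_combination e33 / 2)
  have hδ : (p * q' - p' * q) * (r * s' - r' * s) = 1 := by
    simp only [h0, h1, h2, h3, h0', h1', h2', h3'] at e03
    linear_combination e03
  refine ⟨!![(r * s' - r' * s) * p, p'; (r * s' - r' * s) * q, q'],
    !![(p * q' - p' * q) * r, r'; (p * q' - p' * q) * s, s'], ?_, ?_, fun i => ?_⟩
  · rw [det_fin_two_of]; linear_combination hδ
  · rw [det_fin_two_of]; linear_combination hδ
  · rw [kron_eq]
    fin_cases i <;> simp [h0, h1, h2, h3, h0', h1', h2', h3'] <;> grind

lemma exists_eq_kron_of_fixes {N : Matrix (Fin 4) (Fin 4) ℂ} (hN : Nᵀ * detForm * N = detForm)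
    (hdet : N.det = 1) (h0 : ∀ i, N i 0 = (1 : Matrix (Fin 4) (Fin 4) ℂ) i 0)
    (h3 : ∀ i, N i 3 = (1 : Matrix (Fin 4) (Fin 4) ℂ) i 3) :
    ∃ A B : Matrix (Fin 2) (Fin 2) ℂ, A.det = 1 ∧ B.det = 1 ∧ N = kron A B := by
  have e (i j : Fin 4) := (transpose_mul_detForm_mul_apply N i j).symm.trans (congr_fun₂ hN i j)
  have h00 : N 0 0 = 1 := by simp [h0]
  have h10 : N 1 0 = 0 := by simp [h0]
  have h20 : N 2 0 = 0 := by simp [h0]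
  have h30 : N 3 0 = 0 := by simp [h0]
  have h03 : N 0 3 = 0 := by simp [h3]
  have h13 : N 1 3 = 0 := by simp [h3]
  have h23 : N 2 3 = 0 := by simp [h3]
  have h33 : N 3 3 = 1 := by simp [h3]
  have h31 : N 3 1 = 0 := by simpa [detForm, h00, h10, h20, h30] using e 0 1
  have h32 : N 3 2 = 0 := by simpa [detForm, h00, h10, h20, h30] using e 0 2
  have h01 : N 0 1 = 0 := by simpa [detForm, h03, h13, h23, h33] using e 3 1
  have h02 : N 0 2 = 0 := by simpa [detForm, h03, h13, h23, h33] using e 3 2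
  have e11 := e 1 1
  have e12 := e 1 2
  have e22 := e 2 2
  simp only [detForm, of_apply, cons_val, h01, h02, h31, h32] at e11 e12 e22
  have hd : N 1 1 * N 2 2 - N 2 1 * N 1 2 = 1 := by
    rw [← hdet, det_succ_row_zero]
    simp [Fin.sum_univ_four, det_fin_three, Fin.succAbove, h00, h01, h02, h03, h13, h23, h33,
      h31, h32]
    ring
  have hp : N 1 1 * N 2 2 = 1 := by linear_combination hd / 2 - e12 / 2
  have h21 : N 2 1 = 0 := by linear_combination (-N 2 1) * hp - N 2 2 / 2 * e11
  have h12 : N 1 2 = 0 := by linear_combination (-N 1 2) * hp - N 1 1 / 2 * e22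
  obtain ⟨t, ht⟩ := IsAlgClosed.exists_pow_nat_eq (N 1 1) (n := 2) (by norm_num)
  have hs : N 1 1 ≠ 0 := left_ne_zero_of_mul_eq_one hp
  have ht0 : t ≠ 0 := by rintro rfl; exact hs (by simpa using ht.symm)
  have h22 : N 2 2 = t⁻¹ * t⁻¹ := by
    rw [eq_inv_of_mul_eq_one_right hp, ← ht, sq, mul_inv]
  refine ⟨!![t, 0; 0, t⁻¹], !![t⁻¹, 0; 0, t], by simp [ht0], by simp [ht0], ?_⟩
  rw [kron_eq]
  ext i j
  fin_cases i <;> fin_cases j <;>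
    simp [h00, h10, h20, h30, h01, h21, h31, h02, h12, h32, h03, h13, h23, h33, h22, ht0,
      ← ht, sq]

lemma exists_eq_kron {N : Matrix (Fin 4) (Fin 4) ℂ} (hN : Nᵀ * detForm * N = detForm)
    (hdet : N.det = 1) :
    ∃ A B : Matrix (Fin 2) (Fin 2) ℂ, A.det = 1 ∧ B.det = 1 ∧ N = kron A B := by
  obtain ⟨C, D, hC, hD, hCD⟩ := exists_kron_cols_eq hN
  have hCu : IsUnit C.det := by simp [hC]
  have hDu : IsUnit D.det := by simp [hD]
  have hC' : C⁻¹.det = 1 := by simp [det_nonsing_inv, hC]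
  have hD' : D⁻¹.det = 1 := by simp [det_nonsing_inv, hD]
  have hinv : kron C⁻¹ D⁻¹ * kron C D = 1 := by
    rw [kron_mul, nonsing_inv_mul _ hCu, nonsing_inv_mul _ hDu, kron_one_one]
  obtain ⟨A, B, hA, hB, h⟩ := exists_eq_kron_of_fixes (N := kron C⁻¹ D⁻¹ * N)
    (by
      calc (kron C⁻¹ D⁻¹ * N)ᵀ * detForm * (kron C⁻¹ D⁻¹ * N)
          = Nᵀ * ((kron C⁻¹ D⁻¹)ᵀ * detForm * kron C⁻¹ D⁻¹) * N := by
            simp only [transpose_mul, Matrix.mul_assoc]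
        _ = detForm := by
            rw [kron_transpose_mul_detForm_mul_kron, hC', hD', one_mul, one_smul, hN])
    (by rw [det_mul, det_kron, hC', hD', hdet]; norm_num)
    (fun i => by rw [← hinv]; simp only [Matrix.mul_apply, (hCD _).1])
    (fun i => by rw [← hinv]; simp only [Matrix.mul_apply, (hCD _).2])
  refine ⟨C * A, D * B, by simp [hC, hA], by simp [hD, hB], ?_⟩
  rw [← kron_mul, ← h, ← Matrix.mul_assoc, mul_eq_one_comm.mp hinv, Matrix.one_mul]

/-- Every `M ∈ SO(4,ℂ)` is of the form `T (A ⊗ B) T†` with `A, B ∈ SL(2,ℂ)`: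
the homomorphism `SL(2,ℂ)×SL(2,ℂ) → SO(4,ℂ)` is surjective. -/
theorem sl2_sl2_onto_so4_complex (M : Matrix (Fin 4) (Fin 4) ℂ)
    (hM : Mᵀ * M = 1) (hdet : M.det = 1) :
    ∃ A B : Matrix (Fin 2) (Fin 2) ℂ,
      A.det = 1 ∧ B.det = 1 ∧ M = Tmat * kron A B * Tmatᴴ := by
  have hT := Tmat_mul_conjTranspose
  have hT' : Tmatᴴᵀ * Tmatᵀ = 1 := by rw [← transpose_mul, hT, transpose_one]
  obtain ⟨A, B, hA, hB, h⟩ := exists_eq_kron (N := Tmatᴴ * M * Tmat)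
    (by
      calc (Tmatᴴ * M * Tmat)ᵀ * detForm * (Tmatᴴ * M * Tmat)
          = Tmatᵀ * (Mᵀ * (Tmatᴴᵀ * Tmatᵀ) * (Tmat * Tmatᴴ) * M) * Tmat := by
            simp only [← Tmat_transpose_mul, transpose_mul, Matrix.mul_assoc]
        _ = detForm := by
            rw [hT', hT, Matrix.mul_one, Matrix.mul_one, hM, Matrix.mul_one, Tmat_transpose_mul])
    (by
      have h1 : Tmat.det * Tmatᴴ.det = 1 := by rw [← det_mul, hT, det_one]
      rw [det_mul, det_mul, hdet, mul_one, mul_comm, h1])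
  refine ⟨A, B, hA, hB, ?_⟩
  calc M = (Tmat * Tmatᴴ) * M * (Tmat * Tmatᴴ) := by rw [hT, Matrix.one_mul, Matrix.mul_one]
    _ = Tmat * kron A B * Tmatᴴ := by rw [← h]; simp only [Matrix.mul_assoc]
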